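/- In the free SMI category M, if f : A → B is an arrow term such that A and B are pure, then there exists an arrow term f' : ν(A) → ν(B) in which δ, σ, w, κ, ⊤ and ⊥ do not occur, such that f = i_B⁻¹ ∘ f' ∘ i_A, where i_A : A → ν(A) and i_B : B → ν(B) are the canonical directed isomorphisms. -/

import Mathlib

namespace SMI

/-- Objects of the free symmetric bimonoidal intermuting category 𝓜 :
propositional formulas over an infinite set of letters (indexed by ℕ),
the constants ⊥ and ⊤, and the connectives ∨ and ∧. -/
inductive Frm : Type
  | pl : ℕ → Frm
  | bot : Frm
  | top : Frm
  | or : Frm → Frm → Frm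
  | and : Frm → Frm → Frm
  deriving DecidableEq

/-- Arrow terms of 𝓜 , generated from the primitive arrow terms
(associativity b, symmetry c, unit isomorphisms δ and σ, intermutation cᵏ,
the w-arrows and κ) by composition, ∨ and ∧.  The suffixes `To`/`From`
record the direction (`→`/`←`) of the corresponding isomorphism. -/
inductive Tm : Frm → Frm → Type
  | id (A : Frm) : Tm A A
  | comp {A B C : Frm} : Tm B C → Tm A B → Tm A C
  | orM {A B C D : Frm} : Tm A B → Tm C D → Tm (A.or C) (B.or D)
  | andM {A B C D : Frm} : Tm A B → Tm C D → Tm (A.and C) (B.and D)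
  | bOrTo (A B C : Frm) : Tm (A.or (B.or C)) ((A.or B).or C)
  | bOrFrom (A B C : Frm) : Tm ((A.or B).or C) (A.or (B.or C))
  | bAndTo (A B C : Frm) : Tm (A.and (B.and C)) ((A.and B).and C)
  | bAndFrom (A B C : Frm) : Tm ((A.and B).and C) (A.and (B.and C))
  | cOr (A B : Frm) : Tm (A.or B) (B.or A)
  | cAnd (A B : Frm) : Tm (A.and B) (B.and A)
  | dOrTo (A : Frm) : Tm (A.or Frm.bot) A
  | dOrFrom (A : Frm) : Tm A (A.or Frm.bot)
  | sOrTo (A : Frm) : Tm (Frm.bot.or A) A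
  | sOrFrom (A : Frm) : Tm A (Frm.bot.or A)
  | dAndTo (A : Frm) : Tm (A.and Frm.top) A
  | dAndFrom (A : Frm) : Tm A (A.and Frm.top)
  | sAndTo (A : Frm) : Tm (Frm.top.and A) A
  | sAndFrom (A : Frm) : Tm A (Frm.top.and A)
  | ck (A B C D : Frm) : Tm ((A.and B).or (C.and D)) ((A.or C).and (B.or D))
  | wAndTo : Tm (Frm.bot.and Frm.bot) Frm.bot
  | wAndFrom : Tm Frm.bot (Frm.bot.and Frm.bot)
  | wOrTo : Tm (Frm.top.or Frm.top) Frm.top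
  | wOrFrom : Tm Frm.top (Frm.top.or Frm.top)
  | kappa : Tm Frm.bot Frm.top

/-- The equality of arrows of the free SMI category 𝓜 : the smallest
congruence (with respect to ∘, ∨, ∧) containing the equations of the two
symmetric monoidal structures, the naturality and isomorphism conditions,
and the thirteen coherence diagrams (1)-(13) of an SMI category. -/
inductive MEq : ∀ {A B : Frm}, Tm A B → Tm A B → Prop
  -- equivalence
  | refl {A B : Frm} (f : Tm A B) : MEq f f
  | symm {A B : Frm} {f g : Tm A B} : MEq f g → MEq g f
  | trans {A B : Frm} {f g h : Tm A B} : MEq f g → MEq g h → MEq f h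
  -- congruence
  | comp_congr {A B C : Frm} {g g' : Tm B C} {f f' : Tm A B} :
      MEq g g' → MEq f f' → MEq (g.comp f) (g'.comp f')
  | or_congr {A B C D : Frm} {f f' : Tm A B} {g g' : Tm C D} :
      MEq f f' → MEq g g' → MEq (f.orM g) (f'.orM g')
  | and_congr {A B C D : Frm} {f f' : Tm A B} {g g' : Tm C D} :
      MEq f f' → MEq g g' → MEq (f.andM g) (f'.andM g')
  -- category
  | id_comp {A B : Frm} (f : Tm A B) : MEq ((Tm.id B).comp f) f
  | comp_id {A B : Frm} (f : Tm A B) : MEq (f.comp (Tm.id A)) f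
  | comp_assoc {A B C D : Frm} (h : Tm C D) (g : Tm B C) (f : Tm A B) :
      MEq ((h.comp g).comp f) (h.comp (g.comp f))
  -- ∨ and ∧ are biendofunctors
  | or_id (A B : Frm) : MEq ((Tm.id A).orM (Tm.id B)) (Tm.id (A.or B))
  | and_id (A B : Frm) : MEq ((Tm.id A).andM (Tm.id B)) (Tm.id (A.and B))
  | or_comp {A B C A' B' C' : Frm} (g : Tm B C) (f : Tm A B) (g' : Tm B' C') (f' : Tm A' B') :
      MEq ((g.comp f).orM (g'.comp f')) ((g.orM g').comp (f.orM f'))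
  | and_comp {A B C A' B' C' : Frm} (g : Tm B C) (f : Tm A B) (g' : Tm B' C') (f' : Tm A' B') :
      MEq ((g.comp f).andM (g'.comp f')) ((g.andM g').comp (f.andM f'))
  -- naturality
  | bOr_nat {A A' B B' C C' : Frm} (f : Tm A A') (g : Tm B B') (h : Tm C C') :
      MEq ((Tm.bOrTo A' B' C').comp (f.orM (g.orM h))) (((f.orM g).orM h).comp (Tm.bOrTo A B C))
  | bAnd_nat {A A' B B' C C' : Frm} (f : Tm A A') (g : Tm B B') (h : Tm C C') :
      MEq ((Tm.bAndTo A' B' C').comp (f.andM (g.andM h))) (((f.andM g).andM h).comp (Tm.bAndTo A B C))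
  | cOr_nat {A A' B B' : Frm} (f : Tm A A') (g : Tm B B') :
      MEq ((Tm.cOr A' B').comp (f.orM g)) ((g.orM f).comp (Tm.cOr A B))
  | cAnd_nat {A A' B B' : Frm} (f : Tm A A') (g : Tm B B') :
      MEq ((Tm.cAnd A' B').comp (f.andM g)) ((g.andM f).comp (Tm.cAnd A B))
  | dOr_nat {A A' : Frm} (f : Tm A A') :
      MEq ((Tm.dOrTo A').comp (f.orM (Tm.id Frm.bot))) (f.comp (Tm.dOrTo A))
  | sOr_nat {A A' : Frm} (f : Tm A A') :
      MEq ((Tm.sOrTo A').comp ((Tm.id Frm.bot).orM f)) (f.comp (Tm.sOrTo A))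
  | dAnd_nat {A A' : Frm} (f : Tm A A') :
      MEq ((Tm.dAndTo A').comp (f.andM (Tm.id Frm.top))) (f.comp (Tm.dAndTo A))
  | sAnd_nat {A A' : Frm} (f : Tm A A') :
      MEq ((Tm.sAndTo A').comp ((Tm.id Frm.top).andM f)) (f.comp (Tm.sAndTo A))
  | ck_nat {A A' B B' C C' D D' : Frm}
      (f : Tm A A') (g : Tm B B') (h : Tm C C') (k : Tm D D') :
      MEq ((Tm.ck A' B' C' D').comp ((f.andM g).orM (h.andM k)))
          (((f.orM h).andM (g.orM k)).comp (Tm.ck A B C D))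
  -- the primitive arrows other than cᵏ and κ are isomorphisms
  | bOr_iso1 (A B C : Frm) : MEq ((Tm.bOrTo A B C).comp (Tm.bOrFrom A B C)) (Tm.id _)
  | bOr_iso2 (A B C : Frm) : MEq ((Tm.bOrFrom A B C).comp (Tm.bOrTo A B C)) (Tm.id _)
  | bAnd_iso1 (A B C : Frm) : MEq ((Tm.bAndTo A B C).comp (Tm.bAndFrom A B C)) (Tm.id _)
  | bAnd_iso2 (A B C : Frm) : MEq ((Tm.bAndFrom A B C).comp (Tm.bAndTo A B C)) (Tm.id _)
  | dOr_iso1 (A : Frm) : MEq ((Tm.dOrTo A).comp (Tm.dOrFrom A)) (Tm.id _)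
  | dOr_iso2 (A : Frm) : MEq ((Tm.dOrFrom A).comp (Tm.dOrTo A)) (Tm.id _)
  | sOr_iso1 (A : Frm) : MEq ((Tm.sOrTo A).comp (Tm.sOrFrom A)) (Tm.id _)
  | sOr_iso2 (A : Frm) : MEq ((Tm.sOrFrom A).comp (Tm.sOrTo A)) (Tm.id _)
  | dAnd_iso1 (A : Frm) : MEq ((Tm.dAndTo A).comp (Tm.dAndFrom A)) (Tm.id _)
  | dAnd_iso2 (A : Frm) : MEq ((Tm.dAndFrom A).comp (Tm.dAndTo A)) (Tm.id _)
  | sAnd_iso1 (A : Frm) : MEq ((Tm.sAndTo A).comp (Tm.sAndFrom A)) (Tm.id _)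
  | sAnd_iso2 (A : Frm) : MEq ((Tm.sAndFrom A).comp (Tm.sAndTo A)) (Tm.id _)
  | wOr_iso1 : MEq (Tm.wOrTo.comp Tm.wOrFrom) (Tm.id _)
  | wOr_iso2 : MEq (Tm.wOrFrom.comp Tm.wOrTo) (Tm.id _)
  | wAnd_iso1 : MEq (Tm.wAndTo.comp Tm.wAndFrom) (Tm.id _)
  | wAnd_iso2 : MEq (Tm.wAndFrom.comp Tm.wAndTo) (Tm.id _)
  | cOr_inv (A B : Frm) : MEq ((Tm.cOr B A).comp (Tm.cOr A B)) (Tm.id _)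
  | cAnd_inv (A B : Frm) : MEq ((Tm.cAnd B A).comp (Tm.cAnd A B)) (Tm.id _)
  -- Mac Lane coherence for the two symmetric monoidal structures
  | pentagonOr (A B C D : Frm) :
      MEq ((Tm.bOrTo (A.or B) C D).comp (Tm.bOrTo A B (C.or D)))
          (((Tm.bOrTo A B C).orM (Tm.id D)).comp
            ((Tm.bOrTo A (B.or C) D).comp ((Tm.id A).orM (Tm.bOrTo B C D))))
  | pentagonAnd (A B C D : Frm) :
      MEq ((Tm.bAndTo (A.and B) C D).comp (Tm.bAndTo A B (C.and D)))
          (((Tm.bAndTo A B C).andM (Tm.id D)).comp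
            ((Tm.bAndTo A (B.and C) D).comp ((Tm.id A).andM (Tm.bAndTo B C D))))
  | triangleOr (A B : Frm) :
      MEq (((Tm.dOrTo A).orM (Tm.id B)).comp (Tm.bOrTo A Frm.bot B))
          ((Tm.id A).orM (Tm.sOrTo B))
  | triangleAnd (A B : Frm) :
      MEq (((Tm.dAndTo A).andM (Tm.id B)).comp (Tm.bAndTo A Frm.top B))
          ((Tm.id A).andM (Tm.sAndTo B))
  | hexagonOr (A B C : Frm) :
      MEq ((Tm.bOrTo C A B).comp ((Tm.cOr (A.or B) C).comp (Tm.bOrTo A B C)))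
          (((Tm.cOr A C).orM (Tm.id B)).comp
            ((Tm.bOrTo A C B).comp ((Tm.id A).orM (Tm.cOr B C))))
  | hexagonAnd (A B C : Frm) :
      MEq ((Tm.bAndTo C A B).comp ((Tm.cAnd (A.and B) C).comp (Tm.bAndTo A B C)))
          (((Tm.cAnd A C).andM (Tm.id B)).comp
            ((Tm.bAndTo A C B).comp ((Tm.id A).andM (Tm.cAnd B C))))
  | sigmaOr_c (A : Frm) : MEq (Tm.sOrTo A) ((Tm.dOrTo A).comp (Tm.cOr Frm.bot A))
  | sigmaAnd_c (A : Frm) : MEq (Tm.sAndTo A) ((Tm.dAndTo A).comp (Tm.cAnd Frm.top A))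
  -- the thirteen SMI diagrams
  | diag1 (A B C D E F : Frm) :
      MEq ((Tm.bAndTo (A.or D) (B.or E) (C.or F)).comp
            (((Tm.id (A.or D)).andM (Tm.ck B C E F)).comp (Tm.ck A (B.and C) D (E.and F))))
          (((Tm.ck A B D E).andM (Tm.id (C.or F))).comp
            ((Tm.ck (A.and B) C (D.and E) F).comp ((Tm.bAndTo A B C).orM (Tm.bAndTo D E F))))
  | diag2 (A B C D E F : Frm) :
      MEq (((Tm.bOrTo A B C).andM (Tm.bOrTo D E F)).comp
            ((Tm.ck A D (B.or C) (E.or F)).comp ((Tm.id (A.and D)).orM (Tm.ck B E C F))))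
          ((Tm.ck (A.or B) (D.or E) C F).comp
            (((Tm.ck A D B E).orM (Tm.id (C.and F))).comp
              (Tm.bOrTo (A.and D) (B.and E) (C.and F))))
  | diag3 (A B C D : Frm) :
      MEq ((Tm.cAnd (A.or C) (B.or D)).comp (Tm.ck A B C D))
          ((Tm.ck B A D C).comp ((Tm.cAnd A B).orM (Tm.cAnd C D)))
  | diag4 (A B C D : Frm) :
      MEq ((Tm.ck B D A C).comp (Tm.cOr (A.and C) (B.and D)))
          (((Tm.cOr A B).andM (Tm.cOr C D)).comp (Tm.ck A C B D))
  | diag5 (A B : Frm) :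
      MEq (Tm.ck A B Frm.bot Frm.bot)
          (((Tm.dOrFrom A).andM (Tm.dOrFrom B)).comp
            ((Tm.dOrTo (A.and B)).comp ((Tm.id (A.and B)).orM Tm.wAndTo)))
  | diag6 (A B : Frm) :
      MEq (Tm.ck A Frm.top B Frm.top)
          (((Tm.id (A.or B)).andM Tm.wOrFrom).comp
            ((Tm.dAndFrom (A.or B)).comp ((Tm.dAndTo A).orM (Tm.dAndTo B))))
  | diag7 :
      MEq (Tm.bOrTo Frm.top Frm.top Frm.top)
          ((Tm.wOrFrom.orM (Tm.id Frm.top)).comp ((Tm.id Frm.top).orM Tm.wOrTo))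
  | diag8 :
      MEq (Tm.bAndTo Frm.bot Frm.bot Frm.bot)
          ((Tm.wAndFrom.andM (Tm.id Frm.bot)).comp ((Tm.id Frm.bot).andM Tm.wAndTo))
  | diag9 :
      MEq ((Tm.id Frm.top).orM Tm.kappa) (Tm.wOrFrom.comp (Tm.dOrTo Frm.top))
  | diag10 :
      MEq ((Tm.id Frm.bot).andM Tm.kappa) ((Tm.dAndFrom Frm.bot).comp Tm.wAndTo)
  | diag11 :
      MEq (Tm.ck Frm.top Frm.bot Frm.bot Frm.top)
          (((Tm.dOrFrom Frm.top).andM (Tm.sOrFrom Frm.top)).comp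
            ((Tm.dAndFrom Frm.top).comp
              (Tm.kappa.comp
                ((Tm.dOrTo Frm.bot).comp ((Tm.sAndTo Frm.bot).orM (Tm.dAndTo Frm.bot))))))
  | diag12 : MEq (Tm.cOr Frm.top Frm.top) (Tm.wOrFrom.comp Tm.wOrTo)
  | diag13 : MEq (Tm.cAnd Frm.bot Frm.bot) (Tm.wAndFrom.comp Tm.wAndTo)

end SMI

namespace SMI

/-- Normalized disjunction : `B∨⊥ ↦ B`, `⊥∨B ↦ B`, `⊤∨⊤ ↦ ⊤`. -/
def orN : Frm → Frm → Frm
  | Frm.bot, B => B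
  | A, Frm.bot => A
  | Frm.top, Frm.top => Frm.top
  | A, B => A.or B

/-- Normalized conjunction : `B∧⊤ ↦ B`, `⊤∧B ↦ B`, `⊥∧⊥ ↦ ⊥`. -/
def andN : Frm → Frm → Frm
  | Frm.top, B => B
  | A, Frm.top => A
  | Frm.bot, Frm.bot => Frm.bot
  | A, B => A.and B

/-- The unit-normal form ν(A), obtained by iterated replacing of subformulas
`B∨⊥`, `⊥∨B`, `B∧⊤`, `⊤∧B` by `B`, of `⊥∧⊥` by `⊥` and of `⊤∨⊤` by `⊤`. -/
def nu : Frm → Frm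
  | Frm.or A B => orN (nu A) (nu B)
  | Frm.and A B => andN (nu A) (nu B)
  | A => A

/-- `⊥` occurs in the formula. -/
def hasBot : Frm → Prop
  | Frm.bot => True
  | Frm.pl _ => False
  | Frm.top => False
  | Frm.or A B => hasBot A ∨ hasBot B
  | Frm.and A B => hasBot A ∨ hasBot B

/-- `⊤` occurs in the formula. -/
def hasTop : Frm → Prop
  | Frm.top => True
  | Frm.pl _ => False
  | Frm.bot => False
  | Frm.or A B => hasTop A ∨ hasTop B
  | Frm.and A B => hasTop A ∨ hasTop B

/-- `A` is ⊥-pure : there is no occurrence of `⊥` in ν(A). -/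
def BotPure (A : Frm) : Prop := ¬ hasBot (nu A)

/-- `A` is ⊤-pure : there is no occurrence of `⊤` in ν(A). -/
def TopPure (A : Frm) : Prop := ¬ hasTop (nu A)

/-- `A` is pure : both ⊥-pure and ⊤-pure. -/
def Pure (A : Frm) : Prop := BotPure A ∧ TopPure A

end SMI

namespace SMI

/-- Directed N_{⊤,⊥}-terms : arrow terms defined by the directed (`→`)
δ-, σ- and w-arrows, identities, composition, ∨ and ∧.  The canonical
isomorphism `i_A : A → ν(A)` is (the equivalence class of) any such term. -/
inductive DirN : ∀ {A B : Frm}, Tm A B → Prop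
  | id (A : Frm) : DirN (Tm.id A)
  | dOrTo (A : Frm) : DirN (Tm.dOrTo A)
  | sOrTo (A : Frm) : DirN (Tm.sOrTo A)
  | dAndTo (A : Frm) : DirN (Tm.dAndTo A)
  | sAndTo (A : Frm) : DirN (Tm.sAndTo A)
  | wAndTo : DirN Tm.wAndTo
  | wOrTo : DirN Tm.wOrTo
  | comp {A B C : Frm} {g : Tm B C} {f : Tm A B} : DirN g → DirN f → DirN (g.comp f)
  | orM {A B C D : Frm} {f : Tm A B} {g : Tm C D} : DirN f → DirN g → DirN (f.orM g)
  | andM {A B C D : Frm} {f : Tm A B} {g : Tm C D} : DirN f → DirN g → DirN (f.andM g)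

/-- Neither `⊥` nor `⊤` occurs in the formula. -/
def NoUnit : Frm → Prop
  | Frm.pl _ => True
  | Frm.bot => False
  | Frm.top => False
  | Frm.or A B => NoUnit A ∧ NoUnit B
  | Frm.and A B => NoUnit A ∧ NoUnit B

/-- Arrow terms in which δ, σ, w, κ, ⊤ and ⊥ do not occur : terms built
from identities, b, c and cᵏ indexed by unit-free formulas. -/
inductive UFTm : ∀ {A B : Frm}, Tm A B → Prop
  | id {A : Frm} : NoUnit A → UFTm (Tm.id A)
  | comp {A B C : Frm} {g : Tm B C} {f : Tm A B} : UFTm g → UFTm f → UFTm (g.comp f)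
  | orM {A B C D : Frm} {f : Tm A B} {g : Tm C D} : UFTm f → UFTm g → UFTm (f.orM g)
  | andM {A B C D : Frm} {f : Tm A B} {g : Tm C D} : UFTm f → UFTm g → UFTm (f.andM g)
  | bOrTo {A B C : Frm} : NoUnit A → NoUnit B → NoUnit C → UFTm (Tm.bOrTo A B C)
  | bOrFrom {A B C : Frm} : NoUnit A → NoUnit B → NoUnit C → UFTm (Tm.bOrFrom A B C)
  | bAndTo {A B C : Frm} : NoUnit A → NoUnit B → NoUnit C → UFTm (Tm.bAndTo A B C)
  | bAndFrom {A B C : Frm} : NoUnit A → NoUnit B → NoUnit C → UFTm (Tm.bAndFrom A B C)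
  | cOr {A B : Frm} : NoUnit A → NoUnit B → UFTm (Tm.cOr A B)
  | cAnd {A B : Frm} : NoUnit A → NoUnit B → UFTm (Tm.cAnd A B)
  | ck {A B C D : Frm} : NoUnit A → NoUnit B → NoUnit C → NoUnit D → UFTm (Tm.ck A B C D)

open CategoryTheory

/-- Two arrow terms are identified when they are equal as arrows of 𝓜. -/
def tmSetoid (A B : Frm) : Setoid (Tm A B) where
  r := MEq
  iseqv := ⟨MEq.refl, MEq.symm, MEq.trans⟩

/-- The free SMI category, with arrow terms modulo `MEq` as morphisms. -/
instance : Category Frm where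
  Hom A B := Quotient (tmSetoid A B)
  id A := Quotient.mk _ (Tm.id A)
  comp f g := Quotient.map₂ (fun f g => Tm.comp g f) (fun _ _ hf _ _ hg => .comp_congr hg hf) f g
  id_comp := by rintro A B ⟨f⟩; exact Quotient.sound (.comp_id f)
  comp_id := by rintro A B ⟨f⟩; exact Quotient.sound (.id_comp f)
  assoc := by
    rintro A B C D ⟨f⟩ ⟨g⟩ ⟨h⟩
    exact Quotient.sound (.symm (.comp_assoc h g f))

/-- The morphism represented by an arrow term. -/
def arr {A B : Frm} (f : Tm A B) : A ⟶ B := Quotient.mk (tmSetoid A B) f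

theorem arr_eq_iff {A B : Frm} {f g : Tm A B} : arr f = arr g ↔ MEq f g :=
  ⟨fun h => Quotient.exact h, fun h => Quotient.sound h⟩

theorem arr_comp {A B C : Frm} (g : Tm B C) (f : Tm A B) : arr (g.comp f) = arr f ≫ arr g := rfl

theorem arr_id (A : Frm) : arr (Tm.id A) = 𝟙 A := rfl

/-- The action of `∨` on morphisms. -/
def orMap {A B C D : Frm} (f : A ⟶ B) (g : C ⟶ D) : A.or C ⟶ B.or D :=
  Quotient.map₂ Tm.orM (fun _ _ hf _ _ hg => .or_congr hf hg) f g

/-- The action of `∧` on morphisms. -/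
def andMap {A B C D : Frm} (f : A ⟶ B) (g : C ⟶ D) : A.and C ⟶ B.and D :=
  Quotient.map₂ Tm.andM (fun _ _ hf _ _ hg => .and_congr hf hg) f g

theorem arr_orM {A B C D : Frm} (f : Tm A B) (g : Tm C D) :
    arr (f.orM g) = orMap (arr f) (arr g) := rfl

theorem arr_andM {A B C D : Frm} (f : Tm A B) (g : Tm C D) :
    arr (f.andM g) = andMap (arr f) (arr g) := rfl

@[simp]
theorem orMap_id (A B : Frm) : orMap (𝟙 A) (𝟙 B) = 𝟙 (A.or B) :=
  Quotient.sound (.or_id A B)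

@[simp]
theorem andMap_id (A B : Frm) : andMap (𝟙 A) (𝟙 B) = 𝟙 (A.and B) :=
  Quotient.sound (.and_id A B)

@[simp]
theorem orMap_comp {A B C A' B' C' : Frm} (f : A ⟶ B) (g : B ⟶ C) (f' : A' ⟶ B') (g' : B' ⟶ C') :
    orMap f f' ≫ orMap g g' = orMap (f ≫ g) (f' ≫ g') := by
  rcases f with ⟨f⟩; rcases g with ⟨g⟩; rcases f' with ⟨f'⟩; rcases g' with ⟨g'⟩
  exact Quotient.sound (.symm (.or_comp g f g' f'))

@[simp]
theorem andMap_comp {A B C A' B' C' : Frm} (f : A ⟶ B) (g : B ⟶ C) (f' : A' ⟶ B') (g' : B' ⟶ C') :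
    andMap f f' ≫ andMap g g' = andMap (f ≫ g) (f' ≫ g') := by
  rcases f with ⟨f⟩; rcases g with ⟨g⟩; rcases f' with ⟨f'⟩; rcases g' with ⟨g'⟩
  exact Quotient.sound (.symm (.and_comp g f g' f'))

@[simp]
theorem orMap_comp_assoc {A B C A' B' C' Z : Frm} (f : A ⟶ B) (g : B ⟶ C) (f' : A' ⟶ B')
    (g' : B' ⟶ C') (h : C.or C' ⟶ Z) :
    orMap f f' ≫ orMap g g' ≫ h = orMap (f ≫ g) (f' ≫ g') ≫ h := by
  rw [← Category.assoc, orMap_comp]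

@[simp]
theorem andMap_comp_assoc {A B C A' B' C' Z : Frm} (f : A ⟶ B) (g : B ⟶ C) (f' : A' ⟶ B')
    (g' : B' ⟶ C') (h : C.and C' ⟶ Z) :
    andMap f f' ≫ andMap g g' ≫ h = andMap (f ≫ g) (f' ≫ g') ≫ h := by
  rw [← Category.assoc, andMap_comp]

/-- Associativity of `∨`. -/
def assocOr (A B C : Frm) : A.or (B.or C) ≅ (A.or B).or C where
  hom := arr (.bOrTo A B C)
  inv := arr (.bOrFrom A B C)
  hom_inv_id := Quotient.sound (.bOr_iso2 A B C)
  inv_hom_id := Quotient.sound (.bOr_iso1 A B C)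

/-- Associativity of `∧`. -/
def assocAnd (A B C : Frm) : A.and (B.and C) ≅ (A.and B).and C where
  hom := arr (.bAndTo A B C)
  inv := arr (.bAndFrom A B C)
  hom_inv_id := Quotient.sound (.bAnd_iso2 A B C)
  inv_hom_id := Quotient.sound (.bAnd_iso1 A B C)

/-- The right unit isomorphism of `∨`. -/
def unitOrR (A : Frm) : A.or .bot ≅ A where
  hom := arr (.dOrTo A)
  inv := arr (.dOrFrom A)
  hom_inv_id := Quotient.sound (.dOr_iso2 A)
  inv_hom_id := Quotient.sound (.dOr_iso1 A)

/-- The left unit isomorphism of `∨`. -/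
def unitOrL (A : Frm) : Frm.bot.or A ≅ A where
  hom := arr (.sOrTo A)
  inv := arr (.sOrFrom A)
  hom_inv_id := Quotient.sound (.sOr_iso2 A)
  inv_hom_id := Quotient.sound (.sOr_iso1 A)

/-- The right unit isomorphism of `∧`. -/
def unitAndR (A : Frm) : A.and .top ≅ A where
  hom := arr (.dAndTo A)
  inv := arr (.dAndFrom A)
  hom_inv_id := Quotient.sound (.dAnd_iso2 A)
  inv_hom_id := Quotient.sound (.dAnd_iso1 A)

/-- The left unit isomorphism of `∧`. -/
def unitAndL (A : Frm) : Frm.top.and A ≅ A where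
  hom := arr (.sAndTo A)
  inv := arr (.sAndFrom A)
  hom_inv_id := Quotient.sound (.sAnd_iso2 A)
  inv_hom_id := Quotient.sound (.sAnd_iso1 A)

/-- The isomorphism `⊤ ∨ ⊤ ≅ ⊤`. -/
def topOrTop : Frm.top.or .top ≅ .top where
  hom := arr .wOrTo
  inv := arr .wOrFrom
  hom_inv_id := Quotient.sound .wOr_iso2
  inv_hom_id := Quotient.sound .wOr_iso1

/-- The isomorphism `⊥ ∧ ⊥ ≅ ⊥`. -/
def botAndBot : Frm.bot.and .bot ≅ .bot where
  hom := arr .wAndTo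
  inv := arr .wAndFrom
  hom_inv_id := Quotient.sound .wAnd_iso2
  inv_hom_id := Quotient.sound .wAnd_iso1

/-- Symmetry of `∨`. -/
def symmOr (A B : Frm) : A.or B ≅ B.or A where
  hom := arr (.cOr A B)
  inv := arr (.cOr B A)
  hom_inv_id := Quotient.sound (.cOr_inv A B)
  inv_hom_id := Quotient.sound (.cOr_inv B A)

/-- Symmetry of `∧`. -/
def symmAnd (A B : Frm) : A.and B ≅ B.and A where
  hom := arr (.cAnd A B)
  inv := arr (.cAnd B A)
  hom_inv_id := Quotient.sound (.cAnd_inv A B)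
  inv_hom_id := Quotient.sound (.cAnd_inv B A)

/-- The intermutation morphism. -/
def inter (A B C D : Frm) : (A.and B).or (C.and D) ⟶ (A.or C).and (B.or D) := arr (.ck A B C D)

/-- The morphism `⊥ ⟶ ⊤`. -/
def botTop : Frm.bot ⟶ Frm.top := arr .kappa

theorem assocOr_naturality {A A' B B' C C' : Frm} (f : A ⟶ A') (g : B ⟶ B') (h : C ⟶ C') :
    orMap f (orMap g h) ≫ (assocOr A' B' C').hom =
      (assocOr A B C).hom ≫ orMap (orMap f g) h := by
  rcases f with ⟨f⟩; rcases g with ⟨g⟩; rcases h with ⟨h⟩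
  exact Quotient.sound (.bOr_nat f g h)

theorem assocAnd_naturality {A A' B B' C C' : Frm} (f : A ⟶ A') (g : B ⟶ B') (h : C ⟶ C') :
    andMap f (andMap g h) ≫ (assocAnd A' B' C').hom =
      (assocAnd A B C).hom ≫ andMap (andMap f g) h := by
  rcases f with ⟨f⟩; rcases g with ⟨g⟩; rcases h with ⟨h⟩
  exact Quotient.sound (.bAnd_nat f g h)

theorem symmOr_naturality {A A' B B' : Frm} (f : A ⟶ A') (g : B ⟶ B') :
    orMap f g ≫ (symmOr A' B').hom = (symmOr A B).hom ≫ orMap g f := by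
  rcases f with ⟨f⟩; rcases g with ⟨g⟩
  exact Quotient.sound (.cOr_nat f g)

theorem symmAnd_naturality {A A' B B' : Frm} (f : A ⟶ A') (g : B ⟶ B') :
    andMap f g ≫ (symmAnd A' B').hom = (symmAnd A B).hom ≫ andMap g f := by
  rcases f with ⟨f⟩; rcases g with ⟨g⟩
  exact Quotient.sound (.cAnd_nat f g)

theorem unitOrR_naturality {A A' : Frm} (f : A ⟶ A') :
    orMap f (𝟙 Frm.bot) ≫ (unitOrR A').hom = (unitOrR A).hom ≫ f := by
  rcases f with ⟨f⟩; exact Quotient.sound (.dOr_nat f)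

theorem unitOrL_naturality {A A' : Frm} (f : A ⟶ A') :
    orMap (𝟙 Frm.bot) f ≫ (unitOrL A').hom = (unitOrL A).hom ≫ f := by
  rcases f with ⟨f⟩; exact Quotient.sound (.sOr_nat f)

theorem unitAndR_naturality {A A' : Frm} (f : A ⟶ A') :
    andMap f (𝟙 Frm.top) ≫ (unitAndR A').hom = (unitAndR A).hom ≫ f := by
  rcases f with ⟨f⟩; exact Quotient.sound (.dAnd_nat f)

theorem unitAndL_naturality {A A' : Frm} (f : A ⟶ A') :
    andMap (𝟙 Frm.top) f ≫ (unitAndL A').hom = (unitAndL A).hom ≫ f := by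
  rcases f with ⟨f⟩; exact Quotient.sound (.sAnd_nat f)

theorem inter_naturality {A A' B B' C C' D D' : Frm}
    (f : A ⟶ A') (g : B ⟶ B') (h : C ⟶ C') (k : D ⟶ D') :
    orMap (andMap f g) (andMap h k) ≫ inter A' B' C' D' =
      inter A B C D ≫ andMap (orMap f h) (orMap g k) := by
  rcases f with ⟨f⟩; rcases g with ⟨g⟩; rcases h with ⟨h⟩; rcases k with ⟨k⟩
  exact Quotient.sound (.ck_nat f g h k)

theorem symmOr_unitOrR (A : Frm) :
    (symmOr .bot A).hom ≫ (unitOrR A).hom = (unitOrL A).hom :=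
  Quotient.sound (.symm (.sigmaOr_c A))

theorem symmAnd_unitAndR (A : Frm) :
    (symmAnd .top A).hom ≫ (unitAndR A).hom = (unitAndL A).hom :=
  Quotient.sound (.symm (.sigmaAnd_c A))

theorem symmOr_unitOrL (A : Frm) :
    (symmOr A .bot).hom ≫ (unitOrL A).hom = (unitOrR A).hom := by
  rw [← symmOr_unitOrR]
  exact (symmOr A .bot).hom_inv_id_assoc _

theorem symmAnd_unitAndL (A : Frm) :
    (symmAnd A .top).hom ≫ (unitAndL A).hom = (unitAndR A).hom := by
  rw [← symmAnd_unitAndR]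
  exact (symmAnd A .top).hom_inv_id_assoc _

theorem assocOr_triangle (A B : Frm) :
    (assocOr A .bot B).hom ≫ orMap (unitOrR A).hom (𝟙 B) = orMap (𝟙 A) (unitOrL B).hom :=
  Quotient.sound (.triangleOr A B)

theorem assocAnd_triangle (A B : Frm) :
    (assocAnd A .top B).hom ≫ andMap (unitAndR A).hom (𝟙 B) = andMap (𝟙 A) (unitAndL B).hom :=
  Quotient.sound (.triangleAnd A B)

theorem assocOr_pentagon (A B C D : Frm) :
    (assocOr A B (C.or D)).hom ≫ (assocOr (A.or B) C D).hom =
      (orMap (𝟙 A) (assocOr B C D).hom ≫ (assocOr A (B.or C) D).hom) ≫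
        orMap (assocOr A B C).hom (𝟙 D) :=
  Quotient.sound (.pentagonOr A B C D)

theorem assocAnd_pentagon (A B C D : Frm) :
    (assocAnd A B (C.and D)).hom ≫ (assocAnd (A.and B) C D).hom =
      (andMap (𝟙 A) (assocAnd B C D).hom ≫ (assocAnd A (B.and C) D).hom) ≫
        andMap (assocAnd A B C).hom (𝟙 D) :=
  Quotient.sound (.pentagonAnd A B C D)

/-- The monoidal structure given by `∨` and `⊥`. -/
abbrev orMonoidal : MonoidalCategory Frm :=
  letI : MonoidalCategoryStruct Frm :=
    { tensorObj := Frm.or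
      tensorHom := orMap
      whiskerLeft := fun A _ _ f => orMap (𝟙 A) f
      whiskerRight := fun f A => orMap f (𝟙 A)
      tensorUnit := .bot
      associator := fun A B C => (assocOr A B C).symm
      leftUnitor := unitOrL
      rightUnitor := unitOrR }
  .ofTensorHom
    (id_tensorHom_id := orMap_id)
    (tensorHom_comp_tensorHom := fun f g f' g' => orMap_comp f f' g g')
    (associator_naturality := fun f g h => by
      change orMap (orMap f g) h ≫ (assocOr _ _ _).inv = (assocOr _ _ _).inv ≫ orMap f (orMap g h)
      rw [Iso.comp_inv_eq, Category.assoc, assocOr_naturality, Iso.inv_hom_id_assoc])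
    (leftUnitor_naturality := fun f => unitOrL_naturality f)
    (rightUnitor_naturality := fun f => unitOrR_naturality f)
    (pentagon := fun A B C D => by
      change orMap (assocOr A B C).inv (𝟙 D) ≫ (assocOr A (B.or C) D).inv ≫
        orMap (𝟙 A) (assocOr B C D).inv = (assocOr (A.or B) C D).inv ≫ (assocOr A B (C.or D)).inv
      rw [← cancel_mono ((assocOr A B (C.or D)).hom ≫ (assocOr (A.or B) C D).hom)]
      conv_lhs => rw [assocOr_pentagon]
      simp)
    (triangle := fun A B => by
      change (assocOr A .bot B).inv ≫ orMap (𝟙 A) (unitOrL B).hom = orMap (unitOrR A).hom (𝟙 B)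
      rw [Iso.inv_comp_eq, assocOr_triangle])

/-- The monoidal structure given by `∧` and `⊤`. -/
abbrev andMonoidal : MonoidalCategory Frm :=
  letI : MonoidalCategoryStruct Frm :=
    { tensorObj := Frm.and
      tensorHom := andMap
      whiskerLeft := fun A _ _ f => andMap (𝟙 A) f
      whiskerRight := fun f A => andMap f (𝟙 A)
      tensorUnit := .top
      associator := fun A B C => (assocAnd A B C).symm
      leftUnitor := unitAndL
      rightUnitor := unitAndR }
  .ofTensorHom
    (id_tensorHom_id := andMap_id)
    (tensorHom_comp_tensorHom := fun f g f' g' => andMap_comp f f' g g')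
    (associator_naturality := fun f g h => by
      change andMap (andMap f g) h ≫ (assocAnd _ _ _).inv =
        (assocAnd _ _ _).inv ≫ andMap f (andMap g h)
      rw [Iso.comp_inv_eq, Category.assoc, assocAnd_naturality, Iso.inv_hom_id_assoc])
    (leftUnitor_naturality := fun f => unitAndL_naturality f)
    (rightUnitor_naturality := fun f => unitAndR_naturality f)
    (pentagon := fun A B C D => by
      change andMap (assocAnd A B C).inv (𝟙 D) ≫ (assocAnd A (B.and C) D).inv ≫
        andMap (𝟙 A) (assocAnd B C D).inv =
          (assocAnd (A.and B) C D).inv ≫ (assocAnd A B (C.and D)).inv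
      rw [← cancel_mono ((assocAnd A B (C.and D)).hom ≫ (assocAnd (A.and B) C D).hom)]
      conv_lhs => rw [assocAnd_pentagon]
      simp)
    (triangle := fun A B => by
      change (assocAnd A .top B).inv ≫ andMap (𝟙 A) (unitAndL B).hom =
        andMap (unitAndR A).hom (𝟙 B)
      rw [Iso.inv_comp_eq, assocAnd_triangle])

theorem unitOrL_bot : unitOrL .bot = unitOrR .bot :=
  Iso.ext (@MonoidalCategory.unitors_equal _ _ orMonoidal)

theorem unitAndL_top : unitAndL .top = unitAndR .top :=
  Iso.ext (@MonoidalCategory.unitors_equal _ _ andMonoidal)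

theorem assocOr_unitOrL (A B : Frm) :
    (assocOr .bot A B).hom ≫ orMap (unitOrL A).hom (𝟙 B) = (unitOrL (A.or B)).hom :=
  (@MonoidalCategory.leftUnitor_tensor_hom _ _ orMonoidal A B).symm

theorem assocAnd_unitAndL (A B : Frm) :
    (assocAnd .top A B).hom ≫ andMap (unitAndL A).hom (𝟙 B) = (unitAndL (A.and B)).hom :=
  (@MonoidalCategory.leftUnitor_tensor_hom _ _ andMonoidal A B).symm

theorem assocOr_unitOrR (A B : Frm) :
    (assocOr A B .bot).hom ≫ (unitOrR (A.or B)).hom = orMap (𝟙 A) (unitOrR B).hom :=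
  (Iso.eq_inv_comp _).mp (@MonoidalCategory.rightUnitor_tensor_hom _ _ orMonoidal A B)

theorem assocAnd_unitAndR (A B : Frm) :
    (assocAnd A B .top).hom ≫ (unitAndR (A.and B)).hom = andMap (𝟙 A) (unitAndR B).hom :=
  (Iso.eq_inv_comp _).mp (@MonoidalCategory.rightUnitor_tensor_hom _ _ andMonoidal A B)

theorem inter_bot_right (A B : Frm) :
    inter A B .bot .bot ≫ andMap (unitOrR A).hom (unitOrR B).hom =
      orMap (𝟙 _) botAndBot.hom ≫ (unitOrR (A.and B)).hom := by
  have h : inter A B .bot .bot = (orMap (𝟙 _) botAndBot.hom ≫ (unitOrR (A.and B)).hom) ≫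
      andMap (unitOrR A).inv (unitOrR B).inv := Quotient.sound (.diag5 A B)
  simp [h]

theorem inter_top_right (A B : Frm) :
    inter A .top B .top ≫ andMap (𝟙 _) topOrTop.hom ≫ (unitAndR (A.or B)).hom =
      orMap (unitAndR A).hom (unitAndR B).hom := by
  have h : inter A .top B .top = (orMap (unitAndR A).hom (unitAndR B).hom ≫
      (unitAndR (A.or B)).inv) ≫ andMap (𝟙 _) topOrTop.inv := Quotient.sound (.diag6 A B)
  simp [h]

theorem symmOr_inter (A B C D : Frm) :
    (symmOr (A.and C) (B.and D)).hom ≫ inter B D A C =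
      inter A C B D ≫ andMap (symmOr A B).hom (symmOr C D).hom :=
  Quotient.sound (.diag4 A B C D)

theorem inter_symmAnd (A B C D : Frm) :
    inter A B C D ≫ (symmAnd (A.or C) (B.or D)).hom =
      orMap (symmAnd A B).hom (symmAnd C D).hom ≫ inter B A D C :=
  Quotient.sound (.diag3 A B C D)

theorem inter_bot_left (A B : Frm) :
    inter .bot .bot A B ≫ andMap (unitOrL A).hom (unitOrL B).hom =
      orMap botAndBot.hom (𝟙 _) ≫ (unitOrL (A.and B)).hom := by
  rw [← symmOr_unitOrR, ← symmOr_unitOrR, ← symmOr_unitOrR, ← andMap_comp,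
    ← reassoc_of% symmOr_inter, inter_bot_right, reassoc_of% symmOr_naturality]

theorem inter_top_left (A B : Frm) :
    inter .top A .top B ≫ andMap topOrTop.hom (𝟙 _) ≫ (unitAndL (A.or B)).hom =
      orMap (unitAndL A).hom (unitAndL B).hom := by
  rw [← symmAnd_unitAndR, ← symmAnd_unitAndR, ← symmAnd_unitAndR, ← orMap_comp,
    reassoc_of% symmAnd_naturality, reassoc_of% inter_symmAnd, inter_top_right]

theorem inter_top_bot :
    inter .top .bot .bot .top ≫ andMap (unitOrR .top).hom (unitOrL .top).hom ≫
        (unitAndR .top).hom =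
      orMap (unitAndL .bot).hom (unitAndR .bot).hom ≫ (unitOrR .bot).hom ≫ botTop := by
  have h : inter .top .bot .bot .top =
      (((orMap (unitAndL .bot).hom (unitAndR .bot).hom ≫ (unitOrR .bot).hom) ≫ botTop) ≫
        (unitAndR .top).inv) ≫ andMap (unitOrR .top).inv (unitOrL .top).inv :=
    Quotient.sound .diag11
  simp [h]

theorem inter_bot_top :
    inter .bot .top .top .bot ≫ andMap (unitOrL .top).hom (unitOrR .top).hom ≫
        (unitAndR .top).hom =
      orMap (unitAndR .bot).hom (unitAndL .bot).hom ≫ (unitOrR .bot).hom ≫ botTop := by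
  have h := inter_symmAnd .bot .top .top .bot
  rw [← unitAndL_top, ← symmAnd_unitAndR, reassoc_of% symmAnd_naturality, reassoc_of% h,
    inter_top_bot, reassoc_of% orMap_comp, symmAnd_unitAndL, symmAnd_unitAndR]

theorem assocOr_top :
    (assocOr .top .top .top).hom ≫ orMap topOrTop.hom (𝟙 _) = orMap (𝟙 _) topOrTop.hom := by
  have h : (assocOr .top .top .top).hom = orMap (𝟙 _) topOrTop.hom ≫ orMap topOrTop.inv (𝟙 _) :=
    Quotient.sound .diag7
  simp [h]

theorem assocAnd_bot :
    (assocAnd .bot .bot .bot).hom ≫ andMap botAndBot.hom (𝟙 _) = andMap (𝟙 _) botAndBot.hom := by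
  have h : (assocAnd .bot .bot .bot).hom =
      andMap (𝟙 _) botAndBot.hom ≫ andMap botAndBot.inv (𝟙 _) := Quotient.sound .diag8
  simp [h]

theorem symmOr_top : (symmOr .top .top).hom = 𝟙 _ := by
  have h : (symmOr .top .top).hom = topOrTop.hom ≫ topOrTop.inv := Quotient.sound .diag12
  simp [h]

theorem symmAnd_bot : (symmAnd .bot .bot).hom = 𝟙 _ := by
  have h : (symmAnd .bot .bot).hom = botAndBot.hom ≫ botAndBot.inv := Quotient.sound .diag13
  simp [h]

theorem top_or_botTop : orMap (𝟙 _) botTop ≫ topOrTop.hom = (unitOrR .top).hom := by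
  have h : orMap (𝟙 _) botTop = (unitOrR .top).hom ≫ topOrTop.inv := Quotient.sound .diag9
  simp [h]

theorem bot_and_botTop : andMap (𝟙 _) botTop ≫ (unitAndR .bot).hom = botAndBot.hom := by
  have h : andMap (𝟙 _) botTop = botAndBot.hom ≫ (unitAndR .bot).inv := Quotient.sound .diag10
  simp [h]

theorem botTop_or_top : orMap botTop (𝟙 _) ≫ topOrTop.hom = (unitOrL .top).hom := by
  rw [← symmOr_unitOrR, ← top_or_botTop, ← reassoc_of% symmOr_naturality, symmOr_top,
    Category.id_comp]

theorem botTop_and_bot : andMap botTop (𝟙 _) ≫ (unitAndL .bot).hom = botAndBot.hom := by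
  rw [← symmAnd_unitAndR, reassoc_of% symmAnd_naturality, bot_and_botTop, symmAnd_bot,
    Category.id_comp]

/-- The morphisms that perform the last step of the unit-normalization of a disjunction whose
disjuncts are normal. -/
inductive RedOr : ∀ {X Y Z : Frm}, (X.or Y ⟶ Z) → Prop
  | left (Y : Frm) : RedOr (unitOrL Y).hom
  | right (X : Frm) : RedOr (unitOrR X).hom
  | top : RedOr topOrTop.hom
  | pure {X Y : Frm} : NoUnit X → NoUnit Y → RedOr (𝟙 (X.or Y))

/-- The morphisms that perform the last step of the unit-normalization of a conjunction whose
conjuncts are normal. -/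
inductive RedAnd : ∀ {X Y Z : Frm}, (X.and Y ⟶ Z) → Prop
  | left (Y : Frm) : RedAnd (unitAndL Y).hom
  | right (X : Frm) : RedAnd (unitAndR X).hom
  | bot : RedAnd botAndBot.hom
  | pure {X Y : Frm} : NoUnit X → NoUnit Y → RedAnd (𝟙 (X.and Y))

/-- The morphisms between normal forms that arise as unit-normalizations of arrow terms. -/
inductive NormalHom : ∀ {X Y : Frm}, (X ⟶ Y) → Prop
  | id (X : Frm) : NormalHom (𝟙 X)
  | botTop : NormalHom botTop
  | pure {X Y : Frm} {f : Tm X Y} : UFTm f → NormalHom (arr f)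

theorem UFTm.noUnit {X Y : Frm} {f : Tm X Y} (hf : UFTm f) : NoUnit X ∧ NoUnit Y := by
  induction hf <;> simp_all [NoUnit]

theorem NormalHom.comp {X Y Z : Frm} {f : X ⟶ Y} {g : Y ⟶ Z} (hf : NormalHom f)
    (hg : NormalHom g) : NormalHom (f ≫ g) := by
  cases hf with
  | id => simpa using hg
  | botTop => cases hg with
    | id => simpa using NormalHom.botTop
    | pure h => exact h.noUnit.1.elim
  | pure h => cases hg with
    | id => simpa using NormalHom.pure h
    | botTop => exact h.noUnit.2.elim
    | pure h' => exact .pure (h'.comp h)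

theorem RedOr.unique {X Y Z Z' : Frm} {j : X.or Y ⟶ Z} {j' : X.or Y ⟶ Z'} (h : RedOr j)
    (h' : RedOr j') : Z = Z' ∧ HEq j j' := by
  cases h <;> cases h' <;> simp_all [NoUnit, unitOrL_bot]

theorem RedAnd.unique {X Y Z Z' : Frm} {j : X.and Y ⟶ Z} {j' : X.and Y ⟶ Z'} (h : RedAnd j)
    (h' : RedAnd j') : Z = Z' ∧ HEq j j' := by
  cases h <;> cases h' <;> simp_all [NoUnit, unitAndL_top]

theorem RedOr.symm {X Y Z : Frm} {j : X.or Y ⟶ Z} (h : RedOr j) :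
    ∃ (Z' : Frm) (k : Y.or X ⟶ Z') (f : Z ⟶ Z'),
      RedOr k ∧ NormalHom f ∧ (symmOr X Y).hom ≫ k = j ≫ f := by
  cases h with
  | left => exact ⟨_, _, 𝟙 _, .right _, .id _, by simp [symmOr_unitOrR]⟩
  | right => exact ⟨_, _, 𝟙 _, .left _, .id _, by simp [symmOr_unitOrL]⟩
  | top => exact ⟨_, _, 𝟙 _, .top, .id _, by simp [symmOr_top]⟩
  | pure hX hY => exact ⟨_, _, _, .pure hY hX, .pure (.cOr hX hY), by simp [symmOr]⟩

theorem RedAnd.symm {X Y Z : Frm} {j : X.and Y ⟶ Z} (h : RedAnd j) :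
    ∃ (Z' : Frm) (k : Y.and X ⟶ Z') (f : Z ⟶ Z'),
      RedAnd k ∧ NormalHom f ∧ (symmAnd X Y).hom ≫ k = j ≫ f := by
  cases h with
  | left => exact ⟨_, _, 𝟙 _, .right _, .id _, by simp [symmAnd_unitAndR]⟩
  | right => exact ⟨_, _, 𝟙 _, .left _, .id _, by simp [symmAnd_unitAndL]⟩
  | bot => exact ⟨_, _, 𝟙 _, .bot, .id _, by simp [symmAnd_bot]⟩
  | pure hX hY => exact ⟨_, _, _, .pure hY hX, .pure (.cAnd hX hY), by simp [symmAnd]⟩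

theorem RedOr.assoc {X Y Z V W : Frm} {i : Y.or Z ⟶ V} {j : X.or V ⟶ W} (hi : RedOr i)
    (hj : RedOr j) :
    ∃ (U W' : Frm) (k : X.or Y ⟶ U) (l : U.or Z ⟶ W') (f : W ≅ W'),
      RedOr k ∧ RedOr l ∧ NormalHom f.hom ∧ NormalHom f.inv ∧
        (assocOr X Y Z).hom ≫ orMap k (𝟙 Z) ≫ l = orMap (𝟙 X) i ≫ j ≫ f.hom := by
  cases hi with
  | left =>
    refine ⟨_, _, _, _, Iso.refl _, .right _, hj, .id _, .id _, ?_⟩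
    simp [reassoc_of% assocOr_triangle]
  | right =>
    refine ⟨_, _, _, _, Iso.refl _, hj, .right _, .id _, .id _, ?_⟩
    simp [unitOrR_naturality, reassoc_of% assocOr_unitOrR]
  | top => cases hj with
    | left =>
      refine ⟨_, _, _, _, Iso.refl _, .left _, .top, .id _, .id _, ?_⟩
      simp [unitOrL_naturality, reassoc_of% assocOr_unitOrL]
    | top =>
      refine ⟨_, _, _, _, Iso.refl _, .top, .top, .id _, .id _, ?_⟩
      simp [reassoc_of% assocOr_top]
    | pure _ h => exact h.elim
  | pure hY hZ => cases hj with
    | left =>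
      refine ⟨_, _, _, _, Iso.refl _, .left _, .pure hY hZ, .id _, .id _, ?_⟩
      simp [assocOr_unitOrL]
    | pure hX _ =>
      refine ⟨_, _, _, _, assocOr X Y Z, .pure hX hY, .pure ⟨hX, hY⟩ hZ,
        .pure (.bOrTo hX hY hZ), .pure (.bOrFrom hX hY hZ), ?_⟩
      simp

theorem RedAnd.assoc {X Y Z V W : Frm} {i : Y.and Z ⟶ V} {j : X.and V ⟶ W} (hi : RedAnd i)
    (hj : RedAnd j) :
    ∃ (U W' : Frm) (k : X.and Y ⟶ U) (l : U.and Z ⟶ W') (f : W ≅ W'),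
      RedAnd k ∧ RedAnd l ∧ NormalHom f.hom ∧ NormalHom f.inv ∧
        (assocAnd X Y Z).hom ≫ andMap k (𝟙 Z) ≫ l = andMap (𝟙 X) i ≫ j ≫ f.hom := by
  cases hi with
  | left =>
    refine ⟨_, _, _, _, Iso.refl _, .right _, hj, .id _, .id _, ?_⟩
    simp [reassoc_of% assocAnd_triangle]
  | right =>
    refine ⟨_, _, _, _, Iso.refl _, hj, .right _, .id _, .id _, ?_⟩
    simp [unitAndR_naturality, reassoc_of% assocAnd_unitAndR]
  | bot => cases hj with
    | left =>
      refine ⟨_, _, _, _, Iso.refl _, .left _, .bot, .id _, .id _, ?_⟩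
      simp [unitAndL_naturality, reassoc_of% assocAnd_unitAndL]
    | bot =>
      refine ⟨_, _, _, _, Iso.refl _, .bot, .bot, .id _, .id _, ?_⟩
      simp [reassoc_of% assocAnd_bot]
    | pure _ h => exact h.elim
  | pure hY hZ => cases hj with
    | left =>
      refine ⟨_, _, _, _, Iso.refl _, .left _, .pure hY hZ, .id _, .id _, ?_⟩
      simp [assocAnd_unitAndL]
    | pure hX _ =>
      refine ⟨_, _, _, _, assocAnd X Y Z, .pure hX hY, .pure ⟨hX, hY⟩ hZ,
        .pure (.bAndTo hX hY hZ), .pure (.bAndFrom hX hY hZ), ?_⟩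
      simp

theorem RedOr.map {X Y Z V U W : Frm} {f : X ⟶ Y} {g : Z ⟶ V} {i : X.or Z ⟶ U}
    {j : Y.or V ⟶ W} (hf : NormalHom f) (hg : NormalHom g) (hi : RedOr i) (hj : RedOr j) :
    ∃ h : U ⟶ W, NormalHom h ∧ orMap f g ≫ j = i ≫ h := by
  cases hf with
  | id => cases hg with
    | id =>
      obtain ⟨rfl, h⟩ := hi.unique hj
      cases h
      exact ⟨_, .id _, by simp⟩
    | botTop => cases hj with
      | left => cases hi with
        | left => exact ⟨_, .botTop, unitOrL_naturality _⟩
        | right => exact ⟨_, .botTop, by rw [← unitOrL_bot, unitOrL_naturality]⟩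
        | pure h => exact h.elim
      | top => cases hi with
        | right => exact ⟨_, .id _, by simp [top_or_botTop]⟩
        | pure h => exact h.elim
      | pure _ h => exact h.elim
    | pure hg => cases hj with
      | left => cases hi with
        | left => exact ⟨_, .pure hg, unitOrL_naturality _⟩
        | right => exact hg.noUnit.1.elim
        | pure h => exact h.elim
      | right => exact hg.noUnit.2.elim
      | top => exact hg.noUnit.2.elim
      | pure hX => cases hi with
        | left => exact hX.elim
        | right => exact hg.noUnit.1.elim
        | top => exact hX.elim
        | pure => exact ⟨_, .pure (.orM (.id hX) hg), by simp [arr_orM, arr_id]⟩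
  | botTop => cases hg with
    | id => cases hj with
      | right => cases hi with
        | left => exact ⟨_, .botTop, by rw [unitOrL_bot, unitOrR_naturality]⟩
        | right => exact ⟨_, .botTop, unitOrR_naturality _⟩
        | pure h => exact h.elim
      | top => cases hi with
        | left => exact ⟨_, .id _, by simp [botTop_or_top]⟩
        | pure h => exact h.elim
      | pure h => exact h.elim
    | botTop =>
      have h : orMap botTop botTop ≫ topOrTop.hom = (unitOrL .bot).hom ≫ botTop := by
        rw [← unitOrL_naturality, ← botTop_or_top, orMap_comp_assoc, Category.id_comp,
          Category.comp_id]
      cases hj with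
      | top => cases hi with
        | left => exact ⟨_, .botTop, h⟩
        | right => exact ⟨_, .botTop, by rw [h, unitOrL_bot]⟩
        | pure h => exact h.elim
      | pure h => exact h.elim
    | pure hg => cases hj with
      | right => exact hg.noUnit.2.elim
      | top => exact hg.noUnit.2.elim
      | pure h => exact h.elim
  | pure hf => cases hg with
    | id => cases hj with
      | left => exact hf.noUnit.2.elim
      | right => cases hi with
        | left => exact hf.noUnit.1.elim
        | right => exact ⟨_, .pure hf, unitOrR_naturality _⟩
        | pure _ h => exact h.elim
      | top => exact hf.noUnit.2.elim
      | pure _ hZ => cases hi with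
        | left => exact hf.noUnit.1.elim
        | right => exact hZ.elim
        | top => exact hZ.elim
        | pure => exact ⟨_, .pure (.orM hf (.id hZ)), by simp [arr_orM, arr_id]⟩
    | botTop => cases hj with
      | left => exact hf.noUnit.2.elim
      | top => exact hf.noUnit.2.elim
      | pure _ h => exact h.elim
    | pure hg => cases hj with
      | left => exact hf.noUnit.2.elim
      | right => exact hg.noUnit.2.elim
      | top => exact hf.noUnit.2.elim
      | pure => cases hi with
        | left => exact hf.noUnit.1.elim
        | right => exact hg.noUnit.1.elim
        | top => exact hf.noUnit.1.elim
        | pure => exact ⟨_, .pure (.orM hf hg), by simp [arr_orM]⟩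

theorem RedAnd.map {X Y Z V U W : Frm} {f : X ⟶ Y} {g : Z ⟶ V} {i : X.and Z ⟶ U}
    {j : Y.and V ⟶ W} (hf : NormalHom f) (hg : NormalHom g) (hi : RedAnd i) (hj : RedAnd j) :
    ∃ h : U ⟶ W, NormalHom h ∧ andMap f g ≫ j = i ≫ h := by
  cases hf with
  | id => cases hg with
    | id =>
      obtain ⟨rfl, h⟩ := hi.unique hj
      cases h
      exact ⟨_, .id _, by simp⟩
    | botTop => cases hi with
      | left => cases hj with
        | left => exact ⟨_, .botTop, unitAndL_naturality _⟩
        | right => exact ⟨_, .botTop, by rw [← unitAndL_top, unitAndL_naturality]⟩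
        | pure h => exact h.elim
      | bot => cases hj with
        | right => exact ⟨_, .id _, by simp [bot_and_botTop]⟩
        | pure h => exact h.elim
      | pure _ h => exact h.elim
    | pure hg => cases hj with
      | left => cases hi with
        | left => exact ⟨_, .pure hg, unitAndL_naturality _⟩
        | right => exact hg.noUnit.1.elim
        | pure h => exact h.elim
      | right => exact hg.noUnit.2.elim
      | bot => exact hg.noUnit.2.elim
      | pure hX => cases hi with
        | left => exact hX.elim
        | right => exact hg.noUnit.1.elim
        | bot => exact hX.elim
        | pure => exact ⟨_, .pure (.andM (.id hX) hg), by simp [arr_andM, arr_id]⟩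
  | botTop => cases hg with
    | id => cases hi with
      | right => cases hj with
        | left => exact ⟨_, .botTop, by rw [unitAndL_top, unitAndR_naturality]⟩
        | right => exact ⟨_, .botTop, unitAndR_naturality _⟩
        | pure h => exact h.elim
      | bot => cases hj with
        | left => exact ⟨_, .id _, by simp [botTop_and_bot]⟩
        | pure h => exact h.elim
      | pure h => exact h.elim
    | botTop =>
      have h : andMap botTop botTop ≫ (unitAndL .top).hom = botAndBot.hom ≫ botTop := by
        rw [← botTop_and_bot, Category.assoc, ← unitAndL_naturality, andMap_comp_assoc,
          Category.id_comp, Category.comp_id]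
      cases hi with
      | bot => cases hj with
        | left => exact ⟨_, .botTop, h⟩
        | right => exact ⟨_, .botTop, by rw [← h, unitAndL_top]⟩
        | pure h => exact h.elim
      | pure h => exact h.elim
    | pure hg => cases hi with
      | right => exact hg.noUnit.1.elim
      | bot => exact hg.noUnit.1.elim
      | pure h => exact h.elim
  | pure hf => cases hg with
    | id => cases hj with
      | left => exact hf.noUnit.2.elim
      | right => cases hi with
        | left => exact hf.noUnit.1.elim
        | right => exact ⟨_, .pure hf, unitAndR_naturality _⟩
        | pure _ h => exact h.elim
      | bot => exact hf.noUnit.2.elim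
      | pure _ hZ => cases hi with
        | left => exact hf.noUnit.1.elim
        | right => exact hZ.elim
        | bot => exact hZ.elim
        | pure => exact ⟨_, .pure (.andM hf (.id hZ)), by simp [arr_andM, arr_id]⟩
    | botTop => cases hi with
      | left => exact hf.noUnit.1.elim
      | bot => exact hf.noUnit.1.elim
      | pure _ h => exact h.elim
    | pure hg => cases hj with
      | left => exact hf.noUnit.2.elim
      | right => exact hg.noUnit.2.elim
      | bot => exact hf.noUnit.2.elim
      | pure => cases hi with
        | left => exact hf.noUnit.1.elim
        | right => exact hg.noUnit.1.elim
        | bot => exact hf.noUnit.1.elim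
        | pure => exact ⟨_, .pure (.andM hf hg), by simp [arr_andM]⟩

theorem RedOr.inter {X Y Z W P Q R S T V : Frm} {a : X.and Y ⟶ P} {b : Z.and W ⟶ Q}
    {j : P.or Q ⟶ R} {c : X.or Z ⟶ S} {d : Y.or W ⟶ T} {k : S.and T ⟶ V}
    (ha : RedAnd a) (hb : RedAnd b) (hj : RedOr j) (hc : RedOr c) (hd : RedOr d)
    (hk : RedAnd k) :
    ∃ h : R ⟶ V, NormalHom h ∧ inter X Y Z W ≫ andMap c d ≫ k = orMap a b ≫ j ≫ h := by
  have botLeft : ∀ {Z W Q R S T V : Frm} {b : Z.and W ⟶ Q} {j : Frm.bot.or Q ⟶ R}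
      {c : Frm.bot.or Z ⟶ S} {d : Frm.bot.or W ⟶ T} {k : S.and T ⟶ V}, RedAnd b → RedOr j →
      RedOr c → RedOr d → RedAnd k → ∃ h : R ⟶ V, NormalHom h ∧
        SMI.inter .bot .bot Z W ≫ andMap c d ≫ k = orMap botAndBot.hom b ≫ j ≫ h := by
    intro Z W Q R S T V b j c d k hb hj hc hd hk
    obtain ⟨rfl, h⟩ := hc.unique (.left _); cases h
    obtain ⟨rfl, h⟩ := hd.unique (.left _); cases h
    obtain ⟨rfl, h⟩ := hk.unique hb; cases h
    obtain ⟨rfl, h⟩ := hj.unique (.left _); cases h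
    refine ⟨_, .id _, ?_⟩
    rw [reassoc_of% inter_bot_left, ← unitOrL_naturality, orMap_comp_assoc]
    simp
  have botRight : ∀ {X Y P R S T V : Frm} {a : X.and Y ⟶ P} {j : P.or Frm.bot ⟶ R}
      {c : X.or Frm.bot ⟶ S} {d : Y.or Frm.bot ⟶ T} {k : S.and T ⟶ V}, RedAnd a → RedOr j →
      RedOr c → RedOr d → RedAnd k → ∃ h : R ⟶ V, NormalHom h ∧
        SMI.inter X Y .bot .bot ≫ andMap c d ≫ k = orMap a botAndBot.hom ≫ j ≫ h := by
    intro X Y P R S T V a j c d k ha hj hc hd hk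
    obtain ⟨rfl, h⟩ := hc.unique (.right _); cases h
    obtain ⟨rfl, h⟩ := hd.unique (.right _); cases h
    obtain ⟨rfl, h⟩ := hk.unique ha; cases h
    obtain ⟨rfl, h⟩ := hj.unique (.right _); cases h
    refine ⟨_, .id _, ?_⟩
    rw [reassoc_of% inter_bot_right, ← unitOrR_naturality, orMap_comp_assoc]
    simp
  have topLeft : ∀ {Y W R S T V : Frm} {j : Y.or W ⟶ R} {c : Frm.top.or .top ⟶ S}
      {d : Y.or W ⟶ T} {k : S.and T ⟶ V}, RedOr j → RedOr c → RedOr d → RedAnd k →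
      ∃ h : R ⟶ V, NormalHom h ∧ SMI.inter .top Y .top W ≫ andMap c d ≫ k =
        orMap (unitAndL Y).hom (unitAndL W).hom ≫ j ≫ h := by
    intro Y W R S T V j c d k hj hc hd hk
    obtain ⟨rfl, h⟩ := hc.unique .top; cases h
    obtain ⟨rfl, h⟩ := hk.unique (.left _); cases h
    obtain ⟨rfl, h⟩ := hj.unique hd; cases h
    refine ⟨_, .id _, ?_⟩
    rw [← reassoc_of% inter_top_left, ← reassoc_of% unitAndL_naturality, andMap_comp_assoc]
    simp
  have topRight : ∀ {X Z R S T V : Frm} {j : X.or Z ⟶ R} {c : X.or Z ⟶ S}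
      {d : Frm.top.or .top ⟶ T} {k : S.and T ⟶ V}, RedOr j → RedOr c → RedOr d → RedAnd k →
      ∃ h : R ⟶ V, NormalHom h ∧ SMI.inter X .top Z .top ≫ andMap c d ≫ k =
        orMap (unitAndR X).hom (unitAndR Z).hom ≫ j ≫ h := by
    intro X Z R S T V j c d k hj hc hd hk
    obtain ⟨rfl, h⟩ := hd.unique .top; cases h
    obtain ⟨rfl, h⟩ := hk.unique (.right _); cases h
    obtain ⟨rfl, h⟩ := hj.unique hc; cases h
    refine ⟨_, .id _, ?_⟩
    rw [← reassoc_of% inter_top_right, ← reassoc_of% unitAndR_naturality, andMap_comp_assoc]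
    simp
  cases ha with
  | bot => exact botLeft hb hj hc hd hk
  | left => cases hb with
    | bot => exact botRight (.left _) hj hc hd hk
    | left => exact topLeft hj hc hd hk
    | right => cases hc with
      | top => rw [← unitAndL_top]; exact topLeft hj .top hd hk
      | right => cases hd with
        | top => rw [unitAndL_top]; exact topRight hj (.right _) .top hk
        | left =>
          obtain ⟨rfl, h⟩ := hk.unique (.right _); cases h
          obtain ⟨rfl, h⟩ := hj.unique (.right _); cases h
          exact ⟨_, .botTop, inter_top_bot⟩
        | pure _ h => exact h.elim
      | pure h => exact h.elim
    | pure hZ => cases hc with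
      | right => exact hZ.elim
      | top => exact hZ.elim
      | pure h => exact h.elim
  | right => cases hb with
    | bot => exact botRight (.right _) hj hc hd hk
    | right => exact topRight hj hc hd hk
    | left => cases hd with
      | top => rw [unitAndL_top]; exact topRight hj hc .top hk
      | right => cases hc with
        | top => rw [← unitAndL_top]; exact topLeft hj .top (.right _) hk
        | left =>
          obtain ⟨rfl, h⟩ := hk.unique (.right _); cases h
          obtain ⟨rfl, h⟩ := hj.unique (.right _); cases h
          exact ⟨_, .botTop, inter_bot_top⟩
        | pure _ h => exact h.elim
      | pure h => exact h.elim
    | pure _ hW => cases hd with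
      | right => exact hW.elim
      | top => exact hW.elim
      | pure h => exact h.elim
  | pure hX hY => cases hb with
    | bot => exact botRight (.pure hX hY) hj hc hd hk
    | left => cases hc with
      | left => exact hX.elim
      | top => exact hX.elim
      | pure _ h => exact h.elim
    | right => cases hd with
      | left => exact hY.elim
      | top => exact hY.elim
      | pure _ h => exact h.elim
    | pure hZ hW =>
      obtain ⟨rfl, h⟩ := hc.unique (.pure hX hZ); cases h
      obtain ⟨rfl, h⟩ := hd.unique (.pure hY hW); cases h
      obtain ⟨rfl, h⟩ := hk.unique (.pure ⟨hX, hZ⟩ ⟨hY, hW⟩); cases h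
      obtain ⟨rfl, h⟩ := hj.unique (.pure ⟨hX, hY⟩ ⟨hZ, hW⟩); cases h
      exact ⟨_, .pure (.ck hX hY hZ hW), by simp [SMI.inter]⟩

/-- The canonical morphism to a unit-normal form, defined for formulas whose unit-normal form is
a constant or is free of units. -/
inductive Normalizes : ∀ {A X : Frm}, (A ⟶ X) → Prop
  | pl (n : ℕ) : Normalizes (𝟙 (Frm.pl n))
  | bot : Normalizes (𝟙 Frm.bot)
  | top : Normalizes (𝟙 Frm.top)
  | or {A B X Y Z : Frm} {i : A ⟶ X} {j : B ⟶ Y} {k : X.or Y ⟶ Z} :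
      Normalizes i → Normalizes j → RedOr k → Normalizes (orMap i j ≫ k)
  | and {A B X Y Z : Frm} {i : A ⟶ X} {j : B ⟶ Y} {k : X.and Y ⟶ Z} :
      Normalizes i → Normalizes j → RedAnd k → Normalizes (andMap i j ≫ k)

theorem Normalizes.unique {A X Y : Frm} {i : A ⟶ X} {j : A ⟶ Y} (hi : Normalizes i)
    (hj : Normalizes j) : X = Y ∧ HEq i j := by
  induction hi generalizing Y with
  | pl => cases hj; simp
  | bot => cases hj; simp
  | top => cases hj; simp
  | or _ _ hk ih ih' =>
    cases hj with
    | or h h' hk' =>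
      obtain ⟨rfl, e⟩ := ih h; cases e
      obtain ⟨rfl, e⟩ := ih' h'; cases e
      obtain ⟨rfl, e⟩ := hk.unique hk'; cases e
      simp
  | and _ _ hk ih ih' =>
    cases hj with
    | and h h' hk' =>
      obtain ⟨rfl, e⟩ := ih h; cases e
      obtain ⟨rfl, e⟩ := ih' h'; cases e
      obtain ⟨rfl, e⟩ := hk.unique hk'; cases e
      simp

theorem RedOr.orN_eq {X Y Z : Frm} {k : X.or Y ⟶ Z} (hk : RedOr k) : orN X Y = Z := by
  cases hk with
  | left => rfl
  | right => cases X <;> rfl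
  | top => rfl
  | pure hX hY => cases X <;> cases Y <;> first | rfl | exact hX.elim | exact hY.elim

theorem RedAnd.andN_eq {X Y Z : Frm} {k : X.and Y ⟶ Z} (hk : RedAnd k) : andN X Y = Z := by
  cases hk with
  | left => rfl
  | right => cases X <;> rfl
  | bot => rfl
  | pure hX hY => cases X <;> cases Y <;> first | rfl | exact hX.elim | exact hY.elim

theorem Normalizes.nu_eq {A X : Frm} {i : A ⟶ X} (hi : Normalizes i) : nu A = X := by
  induction hi with
  | pl | bot | top => rfl
  | or _ _ hk ih ih' => rw [nu, ih, ih', hk.orN_eq]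
  | and _ _ hk ih ih' => rw [nu, ih, ih', hk.andN_eq]

theorem NoUnit.normalizes_id {X : Frm} (hX : NoUnit X) : Normalizes (𝟙 X) := by
  induction X with
  | pl => exact .pl _
  | bot | top => exact hX.elim
  | or X Y ih ih' => simpa using Normalizes.or (ih hX.1) (ih' hX.2) (.pure hX.1 hX.2)
  | and X Y ih ih' => simpa using Normalizes.and (ih hX.1) (ih' hX.2) (.pure hX.1 hX.2)

theorem DirN.normalizes {A B X : Frm} {f : Tm A B} (hf : DirN f) {i : B ⟶ X}
    (hi : Normalizes i) : Normalizes (arr f ≫ i) := by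
  induction hf generalizing X with
  | id => simpa [arr_id] using hi
  | dOrTo A =>
    rw [show arr (.dOrTo A) = (unitOrR A).hom from rfl, ← unitOrR_naturality]
    exact hi.or .bot (.right X)
  | sOrTo A =>
    rw [show arr (.sOrTo A) = (unitOrL A).hom from rfl, ← unitOrL_naturality]
    exact Normalizes.bot.or hi (.left X)
  | dAndTo A =>
    rw [show arr (.dAndTo A) = (unitAndR A).hom from rfl, ← unitAndR_naturality]
    exact hi.and .top (.right X)
  | sAndTo A =>
    rw [show arr (.sAndTo A) = (unitAndL A).hom from rfl, ← unitAndL_naturality]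
    exact Normalizes.top.and hi (.left X)
  | wAndTo =>
    cases hi
    simpa [botAndBot] using Normalizes.bot.and .bot .bot
  | wOrTo =>
    cases hi
    simpa [topOrTop] using Normalizes.top.or .top .top
  | comp _ _ ihg ihf => simpa [arr_comp] using ihf (ihg hi)
  | orM _ _ ihf ihg =>
    cases hi with
    | or h h' hk => simpa [arr_orM] using (ihf h).or (ihg h') hk
  | andM _ _ ihf ihg =>
    cases hi with
    | and h h' hk => simpa [arr_andM] using (ihf h).and (ihg h') hk

/-- A morphism lifts if it is conjugate, by canonical morphisms to unit-normal forms, to a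
morphism between normal forms. -/
def Lifts {A B : Frm} (f : A ⟶ B) : Prop :=
  ∃ (X Y : Frm) (i : A ⟶ X) (j : B ⟶ Y) (g : X ⟶ Y),
    Normalizes i ∧ Normalizes j ∧ NormalHom g ∧ f ≫ j = i ≫ g

theorem Lifts.exists_normalHom {A B X Y : Frm} {f : A ⟶ B} (hf : Lifts f) {i : A ⟶ X}
    {j : B ⟶ Y} (hi : Normalizes i) (hj : Normalizes j) :
    ∃ g : X ⟶ Y, NormalHom g ∧ f ≫ j = i ≫ g := by
  obtain ⟨X', Y', i', j', g, hi', hj', hg, e⟩ := hf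
  obtain ⟨rfl, h⟩ := hi.unique hi'; cases h
  obtain ⟨rfl, h⟩ := hj.unique hj'; cases h
  exact ⟨g, hg, e⟩

theorem Lifts.comp {A B C : Frm} {f : A ⟶ B} {g : B ⟶ C} (hf : Lifts f) (hg : Lifts g) :
    Lifts (f ≫ g) := by
  obtain ⟨X, Y, i, j, h, hi, hj, hh, e⟩ := hf
  obtain ⟨_, Z, j', k, h', hj', hk, hh', e'⟩ := hg
  obtain ⟨rfl, h⟩ := hj.unique hj'; cases h
  exact ⟨_, _, _, _, _, hi, hk, hh.comp hh', by rw [Category.assoc, e', reassoc_of% e]⟩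

theorem Lifts.orMap {A B C D X Y : Frm} {f : A ⟶ B} {g : C ⟶ D} (hf : Lifts f) (hg : Lifts g)
    {i : A.or C ⟶ X} {j : B.or D ⟶ Y} (hi : Normalizes i) (hj : Normalizes j) :
    Lifts (orMap f g) := by
  cases hi with
  | or hi₁ hi₂ hk => cases hj with
    | or hj₁ hj₂ hl =>
      obtain ⟨f', hf', ef⟩ := hf.exists_normalHom hi₁ hj₁
      obtain ⟨g', hg', eg⟩ := hg.exists_normalHom hi₂ hj₂
      obtain ⟨h, hh, e⟩ := hk.map hf' hg' hl
      refine ⟨_, _, _, _, h, hi₁.or hi₂ hk, hj₁.or hj₂ hl, hh, ?_⟩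
      rw [orMap_comp_assoc, ef, eg, Category.assoc, ← e, orMap_comp_assoc]

theorem Lifts.andMap {A B C D X Y : Frm} {f : A ⟶ B} {g : C ⟶ D} (hf : Lifts f) (hg : Lifts g)
    {i : A.and C ⟶ X} {j : B.and D ⟶ Y} (hi : Normalizes i) (hj : Normalizes j) :
    Lifts (andMap f g) := by
  cases hi with
  | and hi₁ hi₂ hk => cases hj with
    | and hj₁ hj₂ hl =>
      obtain ⟨f', hf', ef⟩ := hf.exists_normalHom hi₁ hj₁
      obtain ⟨g', hg', eg⟩ := hg.exists_normalHom hi₂ hj₂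
      obtain ⟨h, hh, e⟩ := hk.map hf' hg' hl
      refine ⟨_, _, _, _, h, hi₁.and hi₂ hk, hj₁.and hj₂ hl, hh, ?_⟩
      rw [andMap_comp_assoc, ef, eg, Category.assoc, ← e, andMap_comp_assoc]

theorem lifts_assocOr {A B C V : Frm} {i : A.or (B.or C) ⟶ V} (hi : Normalizes i) :
    Lifts (assocOr A B C).hom ∧ Lifts (assocOr A B C).inv := by
  cases hi with
  | @or _ _ X _ _ i _ v hA hBC hv => cases hBC with
    | @or _ _ Y Z _ j k u hB hC hu =>
      obtain ⟨_, _, s, t, f, hs, ht, hf, hf', e⟩ := hu.assoc hv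
      have h : (assocOr A B C).hom ≫ orMap (orMap i j ≫ s) k ≫ t =
          (orMap i (orMap j k ≫ u) ≫ v) ≫ f.hom := by
        have h₁ : orMap (orMap i j ≫ s) k = orMap (orMap i j) k ≫ orMap s (𝟙 Z) := by simp
        have h₂ : orMap i (orMap j k ≫ u) = orMap i (orMap j k) ≫ orMap (𝟙 X) u := by simp
        rw [h₁, h₂, Category.assoc, ← reassoc_of% assocOr_naturality, e]
        simp only [Category.assoc]
      have hV := hA.or (hB.or hC hu) hv
      have hW := (hA.or hB hs).or hC ht
      refine ⟨⟨_, _, _, _, _, hV, hW, hf, h⟩, ⟨_, _, _, _, _, hW, hV, hf', ?_⟩⟩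
      rw [Iso.inv_comp_eq, ← Category.assoc, h, Category.assoc, f.hom_inv_id, Category.comp_id]

theorem lifts_symmOr {A B X : Frm} {i : A.or B ⟶ X} (hi : Normalizes i) :
    Lifts (symmOr A B).hom := by
  cases hi with
  | or hA hB hj =>
    obtain ⟨_, _, f, hk, hf, e⟩ := hj.symm
    refine ⟨_, _, _, _, f, hA.or hB hj, hB.or hA hk, hf, ?_⟩
    rw [← reassoc_of% symmOr_naturality, e, Category.assoc]

theorem lifts_assocAnd {A B C V : Frm} {i : A.and (B.and C) ⟶ V} (hi : Normalizes i) :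
    Lifts (assocAnd A B C).hom ∧ Lifts (assocAnd A B C).inv := by
  cases hi with
  | @and _ _ X _ _ i _ v hA hBC hv => cases hBC with
    | @and _ _ Y Z _ j k u hB hC hu =>
      obtain ⟨_, _, s, t, f, hs, ht, hf, hf', e⟩ := hu.assoc hv
      have h : (assocAnd A B C).hom ≫ andMap (andMap i j ≫ s) k ≫ t =
          (andMap i (andMap j k ≫ u) ≫ v) ≫ f.hom := by
        have h₁ : andMap (andMap i j ≫ s) k = andMap (andMap i j) k ≫ andMap s (𝟙 Z) := by simp
        have h₂ : andMap i (andMap j k ≫ u) = andMap i (andMap j k) ≫ andMap (𝟙 X) u := by simp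
        rw [h₁, h₂, Category.assoc, ← reassoc_of% assocAnd_naturality, e]
        simp only [Category.assoc]
      have hV := hA.and (hB.and hC hu) hv
      have hW := (hA.and hB hs).and hC ht
      refine ⟨⟨_, _, _, _, _, hV, hW, hf, h⟩, ⟨_, _, _, _, _, hW, hV, hf', ?_⟩⟩
      rw [Iso.inv_comp_eq, ← Category.assoc, h, Category.assoc, f.hom_inv_id, Category.comp_id]

theorem lifts_symmAnd {A B X : Frm} {i : A.and B ⟶ X} (hi : Normalizes i) :
    Lifts (symmAnd A B).hom := by
  cases hi with
  | and hA hB hj =>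
    obtain ⟨_, _, f, hk, hf, e⟩ := hj.symm
    refine ⟨_, _, _, _, f, hA.and hB hj, hB.and hA hk, hf, ?_⟩
    rw [← reassoc_of% symmAnd_naturality, e, Category.assoc]

theorem lifts_inter {A B C D X Y : Frm} {i : (A.and B).or (C.and D) ⟶ X}
    {j : (A.or C).and (B.or D) ⟶ Y} (hi : Normalizes i) (hj : Normalizes j) :
    Lifts (inter A B C D) := by
  cases hi with
  | or hAB hCD hr => cases hAB with
    | and hA hB ha => cases hCD with
      | and hC hD hb => cases hj with
        | and hAC hBD hk => cases hAC with
          | or hA' hC' hc => cases hBD with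
            | or hB' hD' hd =>
              obtain ⟨rfl, e⟩ := hA.unique hA'; cases e
              obtain ⟨rfl, e⟩ := hB.unique hB'; cases e
              obtain ⟨rfl, e⟩ := hC.unique hC'; cases e
              obtain ⟨rfl, e⟩ := hD.unique hD'; cases e
              obtain ⟨f, hf, e⟩ := hr.inter ha hb hc hd hk
              refine ⟨_, _, _, _, f, (hA.and hB ha).or (hC.and hD hb) hr,
                (hA.or hC hc).and (hB.or hD hd) hk, hf, ?_⟩
              rw [← andMap_comp_assoc, ← reassoc_of% inter_naturality, e]
              simp

theorem DirN.lifts {A B X : Frm} {f : Tm A B} (hf : DirN f) {i : B ⟶ X} (hi : Normalizes i) :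
    Lifts (arr f) :=
  ⟨_, _, _, _, 𝟙 X, hf.normalizes hi, hi, .id X, by simp⟩

theorem DirN.lifts_inv {A B X : Frm} {f : A ≅ B} {t : Tm A B} (ht : DirN t) (h : arr t = f.hom)
    {i : B ⟶ X} (hi : Normalizes i) : Lifts f.inv :=
  ⟨_, _, _, _, 𝟙 X, hi, ht.normalizes hi, .id X, by simp [h]⟩

/-- The shape of a unit-normal form: a constant, or a formula that is not a constant, in which
`⊥` occurs or not, and `⊤` occurs or not. -/
inductive Shape : Type
  | bot
  | top
  | pure
  | hasBot
  | hasTop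
  | hasBoth
  deriving DecidableEq

namespace Shape

instance : Fintype Shape :=
  ⟨{bot, top, pure, hasBot, hasTop, hasBoth}, by intro x; cases x <;> decide⟩

/-- The union of the sets of constants that occur. -/
def join : Shape → Shape → Shape
  | bot, bot | bot, pure | bot, hasBot | pure, bot | hasBot, bot => hasBot
  | top, top | top, pure | top, hasTop | pure, top | hasTop, top => hasTop
  | pure, x => x
  | x, pure => x
  | hasBot, hasBot => hasBot
  | hasTop, hasTop => hasTop
  | _, _ => hasBoth

/-- The shape of a disjunction. -/
def or : Shape → Shape → Shape
  | bot, x => x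
  | x, bot => x
  | top, top => top
  | x, y => join x y

/-- The shape of a conjunction. -/
def and : Shape → Shape → Shape
  | top, x => x
  | x, top => x
  | bot, bot => bot
  | x, y => join x y

/-- No `⊥` occurs next to other symbols. -/
def botFree (x : Shape) : Bool := x = pure || x = hasTop

/-- No `⊤` occurs next to other symbols. -/
def topFree (x : Shape) : Bool := x = pure || x = hasBot

/-- The shape is that of a constant. -/
def isConst (x : Shape) : Bool := x = bot || x = top

/-- The shape is that of a constant, or of a formula without constants. -/
def good (x : Shape) : Bool := x = pure || x.isConst

/-- The preorder on shapes along which arrows of 𝓜 go. -/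
def le (x y : Shape) : Bool :=
  (x.isConst == y.isConst) && (!(x = top) || y = top) && (!x.botFree || y.botFree) &&
    (!y.topFree || x.topFree)

theorem le_refl : ∀ x : Shape, x.le x := by decide

theorem le_trans : ∀ x y z : Shape, x.le y → y.le z → x.le z := by decide

theorem or_le_or : ∀ x y z w : Shape, x.le y → z.le w → (x.or z).le (y.or w) := by decide

theorem and_le_and : ∀ x y z w : Shape, x.le y → z.le w → (x.and z).le (y.and w) := by decide

theorem or_assoc : ∀ x y z : Shape, (x.or y).or z = x.or (y.or z) := by decide

theorem and_assoc : ∀ x y z : Shape, (x.and y).and z = x.and (y.and z) := by decide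

theorem or_comm : ∀ x y : Shape, x.or y = y.or x := by decide

theorem and_comm : ∀ x y : Shape, x.and y = y.and x := by decide

theorem inter_le : ∀ x y z w : Shape,
    ((x.and y).or (z.and w)).le ((x.or z).and (y.or w)) := by decide

theorem good_of_le : ∀ x y z : Shape, x.le y → y.le z → x.good → z.good → y.good := by decide

theorem good_of_or : ∀ x y : Shape, (x.or y).good → x.good ∧ y.good := by decide

theorem good_of_and : ∀ x y : Shape, (x.and y).good → x.good ∧ y.good := by decide

end Shape

/-- The shape of the unit-normal form of a formula. -/
def shape : Frm → Shape
  | .pl _ => .pure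
  | .bot => .bot
  | .top => .top
  | .or A B => (shape A).or (shape B)
  | .and A B => (shape A).and (shape B)

namespace Shape

/-- The formulas that have a given shape. -/
def Describes (X : Frm) : Shape → Prop
  | bot => X = .bot
  | top => X = .top
  | pure => ¬SMI.hasBot X ∧ ¬SMI.hasTop X
  | hasBot => X ≠ .bot ∧ SMI.hasBot X ∧ ¬SMI.hasTop X
  | hasTop => X ≠ .top ∧ ¬SMI.hasBot X ∧ SMI.hasTop X
  | hasBoth => SMI.hasBot X ∧ SMI.hasTop X

theorem or_bot (x : Shape) : x.or bot = x := by cases x <;> rfl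

theorem and_top (x : Shape) : x.and top = x := by cases x <;> rfl

theorem describes_bot_iff {x : Shape} : x.Describes .bot ↔ x = bot := by
  cases x <;> simp [Describes, SMI.hasBot, SMI.hasTop]

theorem describes_top_iff {x : Shape} : x.Describes .top ↔ x = top := by
  cases x <;> simp [Describes, SMI.hasBot, SMI.hasTop]

theorem Describes.or {X Y : Frm} {x y : Shape} (hx : x.Describes X) (hy : y.Describes Y) :
    (x.or y).Describes (orN X Y) := by
  by_cases hX : X = .bot
  · subst hX
    rw [describes_bot_iff] at hx
    subst hx
    cases y <;> exact hy
  by_cases hY : Y = .bot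
  · subst hY
    rw [describes_bot_iff] at hy
    subst hy
    rw [or_bot]
    cases X <;> exact hx
  by_cases hXY : X = .top ∧ Y = .top
  · obtain ⟨rfl, rfl⟩ := hXY
    rw [describes_top_iff] at hx hy
    subst hx hy
    rfl
  have h : orN X Y = X.or Y := by cases X <;> cases Y <;> simp_all [orN]
  rw [h]
  cases x <;> cases y <;> simp_all [Describes, Shape.or, join, SMI.hasBot, SMI.hasTop]

theorem Describes.and {X Y : Frm} {x y : Shape} (hx : x.Describes X) (hy : y.Describes Y) :
    (x.and y).Describes (andN X Y) := by
  by_cases hX : X = .top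
  · subst hX
    rw [describes_top_iff] at hx
    subst hx
    cases y <;> exact hy
  by_cases hY : Y = .top
  · subst hY
    rw [describes_top_iff] at hy
    subst hy
    rw [and_top]
    cases X <;> exact hx
  by_cases hXY : X = .bot ∧ Y = .bot
  · obtain ⟨rfl, rfl⟩ := hXY
    rw [describes_bot_iff] at hx hy
    subst hx hy
    rfl
  have h : andN X Y = X.and Y := by cases X <;> cases Y <;> simp_all [andN]
  rw [h]
  cases x <;> cases y <;> simp_all [Describes, Shape.and, join, SMI.hasBot, SMI.hasTop]

end Shape

theorem noUnit_iff {X : Frm} : NoUnit X ↔ ¬hasBot X ∧ ¬hasTop X := by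
  induction X with
  | pl | bot | top => simp [NoUnit, hasBot, hasTop]
  | or X Y ih ih' | and X Y ih ih' => simp only [NoUnit, hasBot, hasTop, ih, ih']; tauto

theorem describes_shape (A : Frm) : (shape A).Describes (nu A) := by
  induction A with
  | pl => exact ⟨id, id⟩
  | bot | top => rfl
  | or A B ih ih' => exact ih.or ih'
  | and A B ih ih' => exact ih.and ih'

theorem Pure.noUnit {A : Frm} (hA : Pure A) : NoUnit (nu A) :=
  noUnit_iff.2 hA

theorem Pure.shape_eq {A : Frm} (hA : Pure A) : shape A = .pure := by
  have h := describes_shape A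
  obtain ⟨h₁, h₂⟩ := hA
  rw [BotPure] at h₁
  rw [TopPure] at h₂
  cases hs : shape A <;> simp_all [Shape.Describes, hasBot, hasTop]

theorem shape_le {A B : Frm} (f : Tm A B) : (shape A).le (shape B) := by
  induction f with
  | id => exact Shape.le_refl _
  | comp _ _ ihg ihf => exact Shape.le_trans _ _ _ ihf ihg
  | orM _ _ ih ih' => exact Shape.or_le_or _ _ _ _ ih ih'
  | andM _ _ ih ih' => exact Shape.and_le_and _ _ _ _ ih ih'
  | bOrTo | bOrFrom => simp only [shape, Shape.or_assoc, Shape.le_refl]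
  | bAndTo | bAndFrom => simp only [shape, Shape.and_assoc, Shape.le_refl]
  | cOr => rw [shape, shape, Shape.or_comm]; exact Shape.le_refl _
  | cAnd => rw [shape, shape, Shape.and_comm]; exact Shape.le_refl _
  | dOrTo | dOrFrom => simp only [shape, Shape.or_bot, Shape.le_refl]
  | sOrTo | sOrFrom => simp only [shape, Shape.or_comm .bot, Shape.or_bot, Shape.le_refl]
  | dAndTo | dAndFrom => simp only [shape, Shape.and_top, Shape.le_refl]
  | sAndTo | sAndFrom => simp only [shape, Shape.and_comm .top, Shape.and_top, Shape.le_refl]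
  | ck => exact Shape.inter_le _ _ _ _
  | wAndTo | wAndFrom | wOrTo | wOrFrom | kappa => rfl

theorem nu_of_good {A : Frm} (h : (shape A).good) :
    nu A = .bot ∨ nu A = .top ∨ NoUnit (nu A) := by
  have hA := describes_shape A
  rw [noUnit_iff]
  cases hs : shape A <;> simp_all [Shape.Describes, Shape.good, Shape.isConst]

theorem exists_normalizes {A : Frm} (h : (shape A).good) :
    ∃ (X : Frm) (i : A ⟶ X), Normalizes i := by
  induction A with
  | pl n => exact ⟨_, _, .pl n⟩
  | bot => exact ⟨_, _, .bot⟩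
  | top => exact ⟨_, _, .top⟩
  | or A B ih ih' =>
    obtain ⟨hA, hB⟩ := Shape.good_of_or _ _ h
    obtain ⟨X, i, hi⟩ := ih hA
    obtain ⟨Y, j, hj⟩ := ih' hB
    have hX := nu_of_good hA
    have hY := nu_of_good hB
    have hXY := nu_of_good h
    rw [hi.nu_eq] at hX
    rw [hj.nu_eq] at hY
    rw [nu, hi.nu_eq, hj.nu_eq] at hXY
    rcases hX with rfl | rfl | hX
    · exact ⟨_, _, hi.or hj (.left Y)⟩
    · rcases hY with rfl | rfl | hY
      · exact ⟨_, _, hi.or hj (.right _)⟩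
      · exact ⟨_, _, hi.or hj .top⟩
      · cases Y <;> simp_all [orN, NoUnit]
    · rcases hY with rfl | rfl | hY
      · exact ⟨_, _, hi.or hj (.right X)⟩
      · cases X <;> simp_all [orN, NoUnit]
      · exact ⟨_, _, hi.or hj (.pure hX hY)⟩
  | and A B ih ih' =>
    obtain ⟨hA, hB⟩ := Shape.good_of_and _ _ h
    obtain ⟨X, i, hi⟩ := ih hA
    obtain ⟨Y, j, hj⟩ := ih' hB
    have hX := nu_of_good hA
    have hY := nu_of_good hB
    have hXY := nu_of_good h
    rw [hi.nu_eq] at hX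
    rw [hj.nu_eq] at hY
    rw [nu, hi.nu_eq, hj.nu_eq] at hXY
    rcases hX with rfl | rfl | hX
    · rcases hY with rfl | rfl | hY
      · exact ⟨_, _, hi.and hj .bot⟩
      · exact ⟨_, _, hi.and hj (.right _)⟩
      · cases Y <;> simp_all [andN, NoUnit]
    · exact ⟨_, _, hi.and hj (.left Y)⟩
    · rcases hY with rfl | rfl | hY
      · cases X <;> simp_all [andN, NoUnit]
      · exact ⟨_, _, hi.and hj (.right X)⟩
      · exact ⟨_, _, hi.and hj (.pure hX hY)⟩

theorem lifts_arr {A B : Frm} (f : Tm A B) (hA : (shape A).good) (hB : (shape B).good) :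
    Lifts (arr f) := by
  induction f with
  | comp g f ihg ihf =>
    have h := Shape.good_of_le _ _ _ (shape_le f) (shape_le g) hA hB
    simpa [arr_comp] using (ihf hA h).comp (ihg h hB)
  | orM f g ihf ihg =>
    obtain ⟨_, _, hi⟩ := exists_normalizes hA
    obtain ⟨_, _, hj⟩ := exists_normalizes hB
    obtain ⟨h₁, h₂⟩ := Shape.good_of_or _ _ hA
    obtain ⟨h₃, h₄⟩ := Shape.good_of_or _ _ hB
    rw [arr_orM]
    exact (ihf h₁ h₃).orMap (ihg h₂ h₄) hi hj
  | andM f g ihf ihg =>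
    obtain ⟨_, _, hi⟩ := exists_normalizes hA
    obtain ⟨_, _, hj⟩ := exists_normalizes hB
    obtain ⟨h₁, h₂⟩ := Shape.good_of_and _ _ hA
    obtain ⟨h₃, h₄⟩ := Shape.good_of_and _ _ hB
    rw [arr_andM]
    exact (ihf h₁ h₃).andMap (ihg h₂ h₄) hi hj
  | kappa => exact ⟨_, _, _, _, _, .bot, .top, .botTop, by simp [botTop]⟩
  | _ =>
    obtain ⟨_, _, hi⟩ := exists_normalizes hA
    obtain ⟨_, _, hj⟩ := exists_normalizes hB
    first
      | exact DirN.lifts (by constructor) hj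
      | exact (lifts_assocOr hi).1
      | exact (lifts_assocOr hj).2
      | exact (lifts_assocAnd hi).1
      | exact (lifts_assocAnd hj).2
      | exact lifts_symmOr hi
      | exact lifts_symmAnd hi
      | exact lifts_inter hi hj
      | exact (DirN.dOrTo _).lifts_inv (f := unitOrR _) rfl hi
      | exact (DirN.sOrTo _).lifts_inv (f := unitOrL _) rfl hi
      | exact (DirN.dAndTo _).lifts_inv (f := unitAndR _) rfl hi
      | exact (DirN.sAndTo _).lifts_inv (f := unitAndL _) rfl hi
      | exact DirN.wAndTo.lifts_inv (f := botAndBot) rfl hi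
      | exact DirN.wOrTo.lifts_inv (f := topOrTop) rfl hi

theorem NormalHom.exists_uFTm {X Y : Frm} {f : X ⟶ Y} (hf : NormalHom f) (hX : NoUnit X) :
    ∃ t : Tm X Y, UFTm t ∧ arr t = f := by
  cases hf with
  | id => exact ⟨_, .id hX, arr_id _⟩
  | botTop => exact hX.elim
  | pure h => exact ⟨_, h, rfl⟩

/-- Lemma 3.6 : if `f : A → B` is an arrow term of 𝓜 with `A` and `B` pure,
then there is an arrow term `f' : ν(A) → ν(B)` in which δ, σ, w, κ, ⊤ and ⊥
do not occur, with `f = i_B⁻¹ ∘ f' ∘ i_A` for the canonical directed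
isomorphisms `i_A : A → ν(A)`, `i_B : B → ν(B)`. -/
theorem reduction_to_pure_part {A B : Frm} (f : Tm A B)
    (hA : Pure A) (hB : Pure B) :
    ∃ f' : Tm (nu A) (nu B), UFTm f' ∧
      ∀ (iA : Tm A (nu A)) (iB : Tm B (nu B)) (iBinv : Tm (nu B) B),
        DirN iA → DirN iB → MEq (iBinv.comp iB) (Tm.id B) →
          MEq f (iBinv.comp (f'.comp iA)) := by
  obtain ⟨X, Y, i, j, g, hi, hj, hg, e⟩ :=
    lifts_arr f (by rw [hA.shape_eq]; rfl) (by rw [hB.shape_eq]; rfl)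
  obtain rfl := hi.nu_eq
  obtain rfl := hj.nu_eq
  obtain ⟨f', hf', rfl⟩ := hg.exists_uFTm hA.noUnit
  refine ⟨f', hf', fun iA iB iBinv hiA hiB h => arr_eq_iff.1 ?_⟩
  have hiA' : arr iA = i := by
    simpa using ((hiA.normalizes hA.noUnit.normalizes_id).unique hi).2
  have hiB' : arr iB = j := by
    simpa using ((hiB.normalizes hB.noUnit.normalizes_id).unique hj).2
  subst hiA' hiB'
  rw [← arr_eq_iff, arr_comp, arr_id] at h
  rw [arr_comp, arr_comp, ← e, Category.assoc, h, Category.comp_id]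

end SMI
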